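/- Let K have characteristic zero and let A = K[x₁,…,xₙ]/(f₁,…,fₙ) be an Artinian complete intersection defined by quadrics satisfying fᵢ^σ = f_{σ(i)} for all σ ∈ Sₙ. Then A has the strong Lefschetz property; moreover if e₁² ∉ (f₁,…,fₙ), then e₁ = x₁+⋯+xₙ is a strong Lefschetz element for A. -/

import Mathlib

open MvPolynomial

section HilbertFunction

/-- Ideals closed under taking homogeneous components. -/
def HomIdeal {K : Type*} [Field K] {n : ℕ} (I : Ideal (MvPolynomial (Fin n) K)) : Prop :=
  ∀ p ∈ I, ∀ d, homogeneousComponent d p ∈ I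

theorem hcomp_mul_gen {K : Type*} [Field K] {n : ℕ} {f : MvPolynomial (Fin n) K} {k : ℕ}
    (hf : f.IsHomogeneous k) (g : MvPolynomial (Fin n) K) (e : ℕ) :
    homogeneousComponent e (f * g) =
      ∑ i ∈ Finset.range (g.totalDegree + 1),
        if k + i = e then f * homogeneousComponent i g else 0 := by
  conv_lhs => rw [← sum_homogeneousComponent g, Finset.mul_sum, map_sum]
  refine Finset.sum_congr rfl fun i _ => ?_
  rw [homogeneousComponent_of_mem (hf.mul (homogeneousComponent_isHomogeneous i g))]
  simp only [eq_comm]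

theorem hcomp_mul {K : Type*} [Field K] {n : ℕ} {f : MvPolynomial (Fin n) K} {k : ℕ}
    (hf : f.IsHomogeneous k) (g : MvPolynomial (Fin n) K) (d : ℕ) :
    homogeneousComponent (k + d) (f * g) = f * homogeneousComponent d g := by
  rw [hcomp_mul_gen hf]
  simp only [add_right_inj]
  rw [Finset.sum_ite_eq' (Finset.range _) d]
  split_ifs with h
  · rfl
  · rw [homogeneousComponent_eq_zero, mul_zero]
    simpa using h

theorem hcomp_mul_lt {K : Type*} [Field K] {n : ℕ} {f : MvPolynomial (Fin n) K} {k : ℕ}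
    (hf : f.IsHomogeneous k) (g : MvPolynomial (Fin n) K) (d : ℕ) (h : d < k) :
    homogeneousComponent d (f * g) = 0 := by
  rw [hcomp_mul_gen hf]
  exact Finset.sum_eq_zero fun i _ => if_neg (by omega)

theorem HomIdeal.sup_span {K : Type*} [Field K] {n : ℕ} {I : Ideal (MvPolynomial (Fin n) K)}
    (hI : HomIdeal I) {f : MvPolynomial (Fin n) K} {k : ℕ} (hf : f.IsHomogeneous k) :
    HomIdeal (I ⊔ Ideal.span {f}) := by
  intro p hp d
  obtain ⟨a, ha, b, hb, rfl⟩ := Submodule.mem_sup.1 hp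
  obtain ⟨c, rfl⟩ := Ideal.mem_span_singleton.1 hb
  rw [map_add]
  refine Ideal.add_mem _ (Ideal.mem_sup_left (hI a ha d)) (Ideal.mem_sup_right ?_)
  by_cases h : d < k
  · rw [hcomp_mul_lt hf _ _ h]; exact Ideal.zero_mem _
  · obtain ⟨e, rfl⟩ := Nat.exists_eq_add_of_le (not_lt.1 h)
    rw [hcomp_mul hf]
    exact Ideal.mem_span_singleton.2 ⟨_, rfl⟩

/-- degree `d` part of the quotient -/
noncomputable abbrev qdeg {K : Type*} [Field K] {n : ℕ} (I : Ideal (MvPolynomial (Fin n) K))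
    (d : ℕ) : Submodule K (MvPolynomial (Fin n) K ⧸ I) :=
  Submodule.map (Ideal.Quotient.mkₐ K I).toLinearMap (homogeneousSubmodule (Fin n) K d)

instance homFin {K : Type*} [Field K] {n : ℕ} (d : ℕ) :
    Module.Finite K (homogeneousSubmodule (Fin n) K d) :=
  Module.Finite.iff_fg.2 (homogeneousSubmodule_fg (σ := Fin n) (R := K) d)

theorem qdeg_step {K : Type*} [Field K] {n : ℕ} {I : Ideal (MvPolynomial (Fin n) K)}
    (hI : HomIdeal I) {f : MvPolynomial (Fin n) K} (hf : f.IsHomogeneous 2)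
    (hr : ∀ g, f * g ∈ I → g ∈ I) (d : ℕ) :
    Module.finrank K (qdeg I (d + 2)) =
      Module.finrank K (qdeg (I ⊔ Ideal.span {f}) (d + 2)) + Module.finrank K (qdeg I d) := by
  set J := I ⊔ Ideal.span {f} with hJ
  have hIJ : I ≤ J := le_sup_left
  let F : (MvPolynomial (Fin n) K ⧸ I) →ₗ[K] (MvPolynomial (Fin n) K ⧸ J) :=
    (Ideal.Quotient.factorₐ K hIJ).toLinearMap
  let G : (MvPolynomial (Fin n) K ⧸ I) →ₗ[K] (MvPolynomial (Fin n) K ⧸ I) :=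
    LinearMap.mulLeft K (Ideal.Quotient.mkₐ K I f)
  have hGinj : Function.Injective G := by
    rw [← LinearMap.ker_eq_bot, LinearMap.ker_eq_bot']
    intro m hm
    obtain ⟨m, rfl⟩ := Ideal.Quotient.mk_surjective m
    change Ideal.Quotient.mk I f * Ideal.Quotient.mk I m = 0 at hm
    rw [← map_mul, Ideal.Quotient.eq_zero_iff_mem] at hm
    exact Ideal.Quotient.eq_zero_iff_mem.2 (hr _ hm)
  let Fr := F.domRestrict (qdeg I (d + 2))
  have h1 := LinearMap.finrank_range_add_finrank_ker Fr
  have h2 : LinearMap.range Fr = qdeg J (d + 2) := by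
    rw [LinearMap.range_domRestrict, qdeg, ← Submodule.map_comp]
    rfl
  have h3 : Submodule.map (qdeg I (d + 2)).subtype (LinearMap.ker Fr) =
      Submodule.map G (qdeg I d) := by
    ext x
    constructor
    · rintro ⟨⟨y, hy⟩, hk, rfl⟩
      obtain ⟨a, ha, rfl⟩ := hy
      have hk' : Ideal.Quotient.mk J a = 0 := hk
      rw [Ideal.Quotient.eq_zero_iff_mem] at hk'
      obtain ⟨i, hi, b, hb, hab⟩ := Submodule.mem_sup.1 hk'
      obtain ⟨c, rfl⟩ := Ideal.mem_span_singleton.1 hb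
      refine ⟨Ideal.Quotient.mk I (homogeneousComponent d c), ⟨_, homogeneousComponent_mem _ _, rfl⟩, ?_⟩
      change Ideal.Quotient.mk I f * Ideal.Quotient.mk I _ = Ideal.Quotient.mk I a
      rw [← map_mul, Ideal.Quotient.eq, ← hcomp_mul hf]
      have : a = homogeneousComponent (2 + d) a := by
        rw [homogeneousComponent_eq_self]
        rw [add_comm]; exact ha
      rw [this, ← hab, map_add, sub_add_cancel_right]
      exact I.neg_mem (hI i hi _)
    · rintro ⟨_, ⟨a, ha, rfl⟩, rfl⟩
      refine ⟨⟨G (Ideal.Quotient.mk I a), ⟨f * a, ?_, ?_⟩⟩, ?_, rfl⟩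
      · rw [add_comm]; exact hf.mul ha
      · change Ideal.Quotient.mk I (f * a) = Ideal.Quotient.mk I f * Ideal.Quotient.mk I a
        rw [map_mul]
      · change Ideal.Quotient.mk J (f * a) = 0
        rw [Ideal.Quotient.eq_zero_iff_mem]
        exact J.mul_mem_right _ (Ideal.mem_sup_right (Ideal.mem_span_singleton_self f))
  have h4 : Module.finrank K (LinearMap.ker Fr) = Module.finrank K (qdeg I d) := by
    rw [← Submodule.finrank_map_subtype_eq, h3]
    exact (LinearEquiv.finrank_eq (Submodule.equivMapOfInjective G hGinj (qdeg I d))).symm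
  rw [h2] at h1
  omega

theorem qdeg_low {K : Type*} [Field K] {n : ℕ} {I : Ideal (MvPolynomial (Fin n) K)}
    (hI : HomIdeal I) {f : MvPolynomial (Fin n) K} (hf : f.IsHomogeneous 2) (d : ℕ) (hd : d < 2) :
    Module.finrank K (qdeg I d) =
      Module.finrank K (qdeg (I ⊔ Ideal.span {f}) d) := by
  set J := I ⊔ Ideal.span {f} with hJ
  have hIJ : I ≤ J := le_sup_left
  let F : (MvPolynomial (Fin n) K ⧸ I) →ₗ[K] (MvPolynomial (Fin n) K ⧸ J) :=
    (Ideal.Quotient.factorₐ K hIJ).toLinearMap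
  let Fr := F.domRestrict (qdeg I d)
  have h1 := LinearMap.finrank_range_add_finrank_ker Fr
  have h2 : LinearMap.range Fr = qdeg J d := by
    rw [LinearMap.range_domRestrict, qdeg, ← Submodule.map_comp]
    rfl
  have h3 : LinearMap.ker Fr = ⊥ := by
    rw [LinearMap.ker_eq_bot']
    rintro ⟨_, a, ha, rfl⟩ hk
    have hk' : Ideal.Quotient.mk J a = 0 := hk
    rw [Ideal.Quotient.eq_zero_iff_mem] at hk'
    obtain ⟨i, hi, b, hb, hab⟩ := Submodule.mem_sup.1 hk'
    obtain ⟨c, rfl⟩ := Ideal.mem_span_singleton.1 hb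
    apply Subtype.ext
    change Ideal.Quotient.mk I a = 0
    rw [Ideal.Quotient.eq_zero_iff_mem]
    have : a = homogeneousComponent d a := by
      rw [homogeneousComponent_eq_self]; exact ha
    rw [this, ← hab, map_add, hcomp_mul_lt hf _ _ hd, add_zero]
    exact hI i hi _
  rw [h2, h3] at h1
  simpa using h1.symm

theorem finrank_homog {K : Type*} [Field K] (n d : ℕ) :
    Module.finrank K (homogeneousSubmodule (Fin n) K d) = n.multichoose d := by
  rw [homogeneousSubmodule_eq_finsupp_supported]
  have e := AddMonoidAlgebra.supportedEquivFinsupp (R := K) (S := K) {m : Fin n →₀ ℕ | m.degree = d}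
  rw [LinearEquiv.finrank_eq e]
  have := Finset.card_finsuppAntidiag_nat_eq_multichoose (s := (Finset.univ : Finset (Fin n))) d
  rw [Finset.card_univ, Fintype.card_fin] at this
  rw [← this]
  have hs : {m : Fin n →₀ ℕ | m.degree = d} = ↑(Finset.finsuppAntidiag (Finset.univ : Finset (Fin n)) d) := by
    ext m; simp [Finset.mem_finsuppAntidiag, Finsupp.degree_eq_sum]
  rw [hs]
  simp

theorem mk_multichoose (n : ℕ) :
    (PowerSeries.mk fun d => (n.multichoose d : ℤ)) * (1 - PowerSeries.X) ^ n = 1 := by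
  induction n with
  | zero =>
    ext d
    cases d <;> simp [PowerSeries.coeff_one]
  | succ n ih =>
    rw [pow_succ', ← mul_assoc]
    convert ih using 2
    ext d
    rw [mul_sub, mul_one, map_sub]
    cases d with
    | zero => simp
    | succ d =>
      rw [PowerSeries.coeff_succ_mul_X]
      simp [Nat.multichoose_succ_succ]

theorem hilbert_choose {K : Type*} [Field K] {n : ℕ}
    (f : Fin n → MvPolynomial (Fin n) K)
    (hquad : ∀ i, (f i).IsHomogeneous 2)
    (hreg : RingTheory.Sequence.IsRegular (MvPolynomial (Fin n) K) (List.ofFn f)) :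
    HomIdeal (Ideal.span (Set.range f)) ∧
    ∀ d, Module.finrank K (qdeg (Ideal.span (Set.range f)) d) = n.choose d := by
  have key : ∀ k ≤ n, HomIdeal (Ideal.ofList ((List.ofFn f).take k)) ∧
      (PowerSeries.mk fun d => (Module.finrank K (qdeg (Ideal.ofList ((List.ofFn f).take k)) d) : ℤ))
        = (1 - PowerSeries.X ^ 2) ^ k * PowerSeries.mk fun d => (n.multichoose d : ℤ) := by
    intro k
    induction k with
    | zero =>
      intro _
      constructor
      · intro p hp d
        simp at hp
        simp [hp]
      · simp only [List.take_zero, pow_zero, one_mul]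
        congr 1
        ext d
        congr 1
        rw [← finrank_homog (K := K)]
        refine (LinearEquiv.finrank_eq (Submodule.equivMapOfInjective _ ?_ _)).symm
        intro a b hab
        have : Ideal.Quotient.mk (Ideal.ofList []) a = Ideal.Quotient.mk (Ideal.ofList []) b := hab
        rw [Ideal.Quotient.eq] at this
        simpa [sub_eq_zero] using this
    | succ k ih =>
      intro hk
      obtain ⟨ih1, ih2⟩ := ih (by omega)
      have hlen : k < (List.ofFn f).length := by simpa using hk
      have e : Ideal.ofList ((List.ofFn f).take (k + 1)) =
          Ideal.ofList ((List.ofFn f).take k) ⊔ Ideal.span {f ⟨k, hk⟩} := by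
        rw [List.take_succ_eq_append_getElem hlen, Ideal.ofList_append, Ideal.ofList_singleton]
        simp
      have hr : ∀ g, f ⟨k, hk⟩ * g ∈ Ideal.ofList ((List.ofFn f).take k) →
          g ∈ Ideal.ofList ((List.ofFn f).take k) := by
        intro g hg
        have := hreg.regular_mod_prev k hlen
        rw [isSMulRegular_iff_right_eq_zero_of_smul] at this
        have h2 := this (Submodule.Quotient.mk g) (by
          rw [← Submodule.Quotient.mk_smul, Submodule.Quotient.mk_eq_zero]
          simpa using hg)
        rw [Submodule.Quotient.mk_eq_zero] at h2
        simpa using h2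
      rw [e]
      refine ⟨ih1.sup_span (hquad _), ?_⟩
      rw [pow_succ', mul_assoc, ← ih2]
      ext d
      rw [sub_mul, one_mul, map_sub]
      by_cases hd : d < 2
      · rw [PowerSeries.coeff_X_pow_mul']
        simp [qdeg_low ih1 (hquad ⟨k, hk⟩) d hd, not_le.2 hd]
      · obtain ⟨d, rfl⟩ := Nat.exists_eq_add_of_le' (not_lt.1 hd)
        rw [PowerSeries.coeff_X_pow_mul]
        simp [qdeg_step ih1 (hquad ⟨k, hk⟩) hr d]
  obtain ⟨h1, h2⟩ := key n le_rfl
  have e : Ideal.ofList ((List.ofFn f).take n) = Ideal.span (Set.range f) := by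
    rw [List.take_of_length_le (by simp), Ideal.ofList]
    congr 1
    ext; simp
  rw [e] at h1 h2
  refine ⟨h1, fun d => ?_⟩
  have h3 : (1 - PowerSeries.X ^ 2 : PowerSeries ℤ) ^ n * (PowerSeries.mk fun d => (n.multichoose d : ℤ))
      = (1 + PowerSeries.X) ^ n := by
    rw [show (1 - PowerSeries.X ^ 2 : PowerSeries ℤ) = (1 + PowerSeries.X) * (1 - PowerSeries.X) by ring,
      mul_pow, mul_assoc, mul_comm ((1 - PowerSeries.X) ^ n), mk_multichoose, mul_one]
  rw [h3] at h2
  have h4 := congrArg (PowerSeries.coeff d) h2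
  have h5 : (1 + PowerSeries.X : PowerSeries ℤ) ^ n = (((1 + Polynomial.X) ^ n : Polynomial ℤ) : PowerSeries ℤ) := by
    simp
  rw [h5, Polynomial.coeff_coe, Polynomial.coeff_one_add_X_pow, PowerSeries.coeff_mk] at h4
  exact_mod_cast h4

end HilbertFunction
section SpechtProducts

/-- `Spe x k V δ`: `δ` is a product of `k` differences of `x` over disjoint pairs covering `V`. -/
inductive Spe {ι R : Type*} [DecidableEq ι] [CommRing R] (x : ι → R) : ℕ → Finset ι → R → Prop
  | one : Spe x 0 ∅ 1
  | step {k : ℕ} {V : Finset ι} {δ : R} (a b : ι) (h : Spe x k V δ) (ha : a ∉ V) (hb : b ∉ V)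
      (hab : a ≠ b) : Spe x (k + 1) (insert a (insert b V)) ((x a - x b) * δ)

theorem Spe.card {ι R : Type*} [DecidableEq ι] [CommRing R] {x : ι → R} {k : ℕ} {V : Finset ι}
    {δ : R} (h : Spe x k V δ) : V.card = 2 * k := by
  induction h with
  | one => simp
  | step a b h ha hb hab ih =>
    rw [Finset.card_insert_of_notMem (by simp [ha, hab]), Finset.card_insert_of_notMem hb, ih]
    ring

theorem Spe.map {ι R S : Type*} [DecidableEq ι] [CommRing R] [CommRing S] (φ : R →+* S)
    {x : ι → R} {k : ℕ} {V : Finset ι}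
    {δ : R} (h : Spe x k V δ) : Spe (fun i => φ (x i)) k V (φ δ) := by
  induction h with
  | one => rw [map_one]; exact Spe.one
  | step a b h ha hb hab ih =>
    rw [map_mul, map_sub]
    exact Spe.step a b ih ha hb hab

theorem Spe.homog {ι K : Type*} [DecidableEq ι] [Field K] {n : ℕ}
    {x : ι → MvPolynomial (Fin n) K} (hx : ∀ i, (x i).IsHomogeneous 1)
    {k : ℕ} {V : Finset ι}
    {δ : MvPolynomial (Fin n) K} (h : Spe x k V δ) : δ.IsHomogeneous k := by
  induction h with
  | one => exact isHomogeneous_one _ _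
  | step a b h ha hb hab ih =>
    rw [add_comm]
    exact ((hx a).sub (hx b)).mul ih

theorem Spe.sum_mul {ι R : Type*} [DecidableEq ι] [CommRing R] {x : ι → R} {k : ℕ} {V : Finset ι}
    {δ : R} (h : Spe x k V δ) (β γ : R) (hx : ∀ i, x i ^ 2 = β * x i + γ) :
    δ * ∑ i ∈ V, x i = k * β * δ := by
  induction h with
  | one => simp
  | @step k V δ a b h ha hb hab ih =>
    rw [Finset.sum_insert (by simp [ha, hab]), Finset.sum_insert hb]
    push_cast
    linear_combination (x a - x b) * ih + δ * hx a - δ * hx b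

theorem spe_rel {ι R : Type*} [Fintype ι] [DecidableEq ι] [CommRing R] {x : ι → R}
    (hx : ∀ i, x i ^ 2 = 0) {k : ℕ} {V : Finset ι} {δ : R} (h : Spe x k V δ)
    {U : Finset ι} (hUV : Disjoint U V) {a : ι} (ha : a ∉ U) (haV : a ∉ V) :
    (((insert a U ∪ V)ᶜ.card : R) + 1) * (δ * ∏ i ∈ insert a U, x i) =
      ∑ b ∈ (insert a U ∪ V)ᶜ, ((x a - x b) * δ) * ∏ i ∈ U, x i
        + (∑ i, x i) * (δ * ∏ i ∈ U, x i) := by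
  have h1 := h.sum_mul 0 0 (by simpa using hx)
  have h2 : (∏ i ∈ U, x i) * ∑ i ∈ U, x i = 0 := by
    rw [Finset.mul_sum]
    refine Finset.sum_eq_zero fun i hi => ?_
    rw [← Finset.mul_prod_erase U x hi, mul_comm, ← mul_assoc, ← sq, hx, zero_mul]
  have hd : Disjoint (insert a U) V := by
    rw [Finset.disjoint_insert_left]; exact ⟨haV, hUV⟩
  have h3 : ∑ i, x i = ∑ i ∈ (insert a U ∪ V)ᶜ, x i + (x a + ∑ i ∈ U, x i + ∑ i ∈ V, x i) := by
    rw [← Finset.sum_insert ha, ← Finset.sum_union hd, Finset.sum_compl_add_sum]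
  rw [← Finset.sum_mul, ← Finset.sum_mul, Finset.sum_sub_distrib, Finset.sum_const,
    Finset.prod_insert ha, nsmul_eq_mul]
  linear_combination (-(δ * ∏ i ∈ U, x i)) * h3 - δ * h2 - (∏ i ∈ U, x i) * h1

/-- spans of Specht products -/
def PSp (K : Type*) {ι R : Type*} [DecidableEq ι] [Field K] [CommRing R] [Algebra K R] (x : ι → R)
    (d : ℕ) : Submodule K R := Submodule.span K {δ | ∃ V, Spe x d V δ}

/-- spans of Specht products times squarefree monomials -/
def ZSp (K : Type*) {ι R : Type*} [DecidableEq ι] [Field K] [CommRing R] [Algebra K R] (x : ι → R)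
    (d : ℕ) : Submodule K R := Submodule.span K
      {z | ∃ k V δ U, Spe x k V δ ∧ Disjoint U V ∧ k + U.card = d ∧ z = δ * ∏ i ∈ U, x i}

theorem zsp_aux {K ι R : Type*} [Fintype ι] [DecidableEq ι] [Field K] [CharZero K] [CommRing R]
    [Algebra K R] (x : ι → R) (J : Ideal R) (hx : ∀ i, x i ^ 2 ∈ J) (d u : ℕ) :
    ∀ (k : ℕ) (V : Finset ι) (δ : R) (U : Finset ι), Spe x k V δ → Disjoint U V → U.card = u →
      k + u = d → δ * ∏ i ∈ U, x i ∈
        PSp K x d ⊔ (ZSp K x (d - 1)).map (LinearMap.mulLeft K (∑ i, x i))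
          ⊔ J.restrictScalars K := by
  induction u with
  | zero =>
    intro k V δ U h _ hU hk
    rw [Finset.card_eq_zero] at hU
    subst hU hk
    refine Submodule.mem_sup_left (Submodule.mem_sup_left (Submodule.subset_span ⟨V, ?_⟩))
    simpa using h
  | succ u ih =>
    intro k V δ U h hUV hU hk
    obtain ⟨a, U, ha, rfl, hU'⟩ := Finset.card_eq_succ.1 hU
    rw [Finset.disjoint_insert_left] at hUV
    set W := PSp K x d ⊔ (ZSp K x (d - 1)).map (LinearMap.mulLeft K (∑ i, x i))
          ⊔ J.restrictScalars K with hW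
    have hrel := spe_rel (x := fun i => Ideal.Quotient.mk J (x i)) (fun i => by
      rw [← map_pow, Ideal.Quotient.eq_zero_iff_mem]; exact hx i)
      (h.map (Ideal.Quotient.mk J)) hUV.2 ha hUV.1
    set r := (insert a U ∪ V)ᶜ with hr
    have hJ : ((r.card : R) + 1) * (δ * ∏ i ∈ insert a U, x i) -
      (∑ b ∈ r, ((x a - x b) * δ) * ∏ i ∈ U, x i
        + (∑ i, x i) * (δ * ∏ i ∈ U, x i)) ∈ J := by
      rw [← Ideal.Quotient.eq]
      simpa using hrel
    have h1 : ∑ b ∈ r, ((x a - x b) * δ) * ∏ i ∈ U, x i ∈ W := by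
      refine Submodule.sum_mem _ fun b hb => ?_
      simp only [hr, Finset.mem_compl, Finset.mem_union, Finset.mem_insert, not_or] at hb
      refine ih (k + 1) _ _ U (Spe.step a b h hUV.1 hb.2 (Ne.symm hb.1.1)) ?_ hU' (by omega)
      rw [Finset.disjoint_insert_right, Finset.disjoint_insert_right]
      exact ⟨ha, hb.1.2, hUV.2⟩
    have h2 : (∑ i, x i) * (δ * ∏ i ∈ U, x i) ∈ W := by
      refine Submodule.mem_sup_left (Submodule.mem_sup_right ⟨_, Submodule.subset_span
        ⟨k, V, δ, U, h, hUV.2, by omega, rfl⟩, rfl⟩)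
    have h3 : ((r.card : R) + 1) * (δ * ∏ i ∈ insert a U, x i) ∈ W := by
      have := W.add_mem (Submodule.mem_sup_right (show _ ∈ J.restrictScalars K from hJ))
        (W.add_mem h1 h2)
      simpa using this
    have h4 : (δ * ∏ i ∈ insert a U, x i) =
        ((r.card : K) + 1)⁻¹ • (((r.card : R) + 1) * (δ * ∏ i ∈ insert a U, x i)) := by
      rw [show ((r.card : R) + 1) = algebraMap K R ((r.card : K) + 1) by simp,
        ← Algebra.smul_def, smul_smul, inv_mul_cancel₀ (Nat.cast_add_one_ne_zero _),
        one_smul]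
    rw [h4]
    exact W.smul_mem _ h3

theorem zsp_le {K ι R : Type*} [Fintype ι] [DecidableEq ι] [Field K] [CharZero K] [CommRing R]
    [Algebra K R] (x : ι → R) (J : Ideal R) (hx : ∀ i, x i ^ 2 ∈ J) (d : ℕ) :
    ZSp K x d ≤ PSp K x d ⊔ (ZSp K x (d - 1)).map (LinearMap.mulLeft K (∑ i, x i))
          ⊔ J.restrictScalars K := by
  rw [ZSp, Submodule.span_le]
  rintro _ ⟨k, V, δ, U, h, hUV, hk, rfl⟩
  exact zsp_aux x J hx d U.card k V δ U h hUV rfl hk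

theorem cover {K ι : Type*} [Fintype ι] [DecidableEq ι] [Field K] {n : ℕ}
    (x : ι → MvPolynomial (Fin n) K) (J : Ideal (MvPolynomial (Fin n) K)) (hx : ∀ i, x i ^ 2 ∈ J)
    (hX : ∀ i, X i ∈ Submodule.span K (Set.range x) ⊔ J.restrictScalars K) (d : ℕ) :
    homogeneousSubmodule (Fin n) K d ≤ ZSp K x d ⊔ J.restrictScalars K := by
  have key : homogeneousSubmodule (Fin n) K d ≤
      Submodule.span K {z | ∃ U : Finset ι, U.card = d ∧ z = ∏ i ∈ U, x i} ⊔ J.restrictScalars K := by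
    have h1 : homogeneousSubmodule (Fin n) K 1 ≤
        Submodule.span K (Set.range x) ⊔ J.restrictScalars K := by
      rw [homogeneousSubmodule_one_eq_span_X, Submodule.span_le]
      rintro _ ⟨i, rfl⟩
      exact hX i
    rw [← homogeneousSubmodule_one_pow]
    induction d with
    | zero =>
      rw [pow_zero, Submodule.one_le]
      exact Submodule.mem_sup_left (Submodule.subset_span ⟨∅, by simp⟩)
    | succ d ih =>
      rw [pow_succ]
      refine (mul_le_mul' ih h1).trans ?_
      have hJl : ∀ a : MvPolynomial (Fin n) K, ∀ j ∈ J.restrictScalars K, a * j ∈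
        Submodule.span K {z | ∃ U : Finset ι, U.card = d + 1 ∧ z = ∏ i ∈ U, x i} ⊔
          J.restrictScalars K := fun a j hj => Submodule.mem_sup_right (J.mul_mem_left a hj)
      rw [Submodule.sup_mul, Submodule.mul_sup, Submodule.span_mul_span]
      refine sup_le (sup_le ?_ ?_) ?_
      · rw [Submodule.span_le]
        rintro _ ⟨_, ⟨U, hU, rfl⟩, _, ⟨i, rfl⟩, rfl⟩
        by_cases hi : i ∈ U
        · refine Submodule.mem_sup_right ?_
          change (∏ j ∈ U, x j) * x i ∈ J
          rw [← Finset.mul_prod_erase U x hi, mul_comm, ← mul_assoc, ← sq]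
          exact J.mul_mem_right _ (hx i)
        · refine Submodule.mem_sup_left (Submodule.subset_span ⟨insert i U, ?_, ?_⟩)
          · rw [Finset.card_insert_of_notMem hi, hU]
          · rw [Finset.prod_insert hi]; exact mul_comm _ _
      · rw [Submodule.mul_le]
        intro a _ j hj
        exact hJl a j hj
      · rw [Submodule.mul_le]
        intro j hj a _
        rw [mul_comm]
        exact hJl a j hj
  refine key.trans (sup_le_sup_right (Submodule.span_mono ?_) _)
  rintro _ ⟨U, hU, rfl⟩
  exact ⟨0, ∅, 1, U, Spe.one, by simp, by simpa using hU, by simp⟩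

theorem falling_step {S : Type*} [CommRing S] (τ w u : S) (hw : w ^ 2 = τ * w) (N : ℕ) :
    ∏ k ∈ Finset.range (N + 1), (u + w - k * τ) =
      ∏ k ∈ Finset.range (N + 1), (u - k * τ) +
        (N + 1) * w * ∏ k ∈ Finset.range N, (u - k * τ) := by
  induction N with
  | zero => simp
  | succ N ih =>
    rw [Finset.prod_range_succ, ih, Finset.prod_range_succ _ (N + 1), Finset.prod_range_succ _ N]
    push_cast
    linear_combination (N + 1) * (∏ k ∈ Finset.range N, (u - k * τ)) * hw

theorem falling {ι S : Type*} [CommRing S] [DecidableEq ι] (τ : S) (w : ι → S)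
    (hw : ∀ i, w i ^ 2 = τ * w i) (s : Finset ι) :
    ∏ k ∈ Finset.range (s.card + 1), (∑ i ∈ s, w i - k * τ) = 0 := by
  induction s using Finset.induction_on with
  | empty => simp
  | insert a s ha ih =>
    rw [Finset.card_insert_of_notMem ha, Finset.sum_insert ha, add_comm (w a),
      falling_step τ (w a) _ (hw a), ih, mul_zero, add_zero, Finset.prod_range_succ, ih, zero_mul]

end SpechtProducts
section Skeleton

theorem skeleton {K : Type*} [Field K] {n : ℕ} {I : Ideal (MvPolynomial (Fin n) K)}
    (hI : HomIdeal I) {l : MvPolynomial (Fin n) K} (hl : l.IsHomogeneous 1)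
    (C : ℕ → Submodule K (MvPolynomial (Fin n) K))
    (hC : ∀ d, C d ≤ homogeneousSubmodule (Fin n) K d)
    (hcov : ∀ d, homogeneousSubmodule (Fin n) K d ≤
      C d ⊔ (I ⊔ Ideal.span {l}).restrictScalars K)
    (hnil : ∀ d, ∀ c ∈ C d, l ^ (n + 1 - 2 * d) * c ∈ I)
    (i : ℕ) (hi : 2 * i ≤ n) (a : MvPolynomial (Fin n) K) (ha : a.IsHomogeneous (n - i)) :
    ∃ a' : MvPolynomial (Fin n) K, a'.IsHomogeneous i ∧ a - l ^ (n - 2 * i) * a' ∈ I := by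
  have key : ∀ m, i + m ≤ n - i → ∀ a : MvPolynomial (Fin n) K, a.IsHomogeneous (i + m) →
      ∃ a' : MvPolynomial (Fin n) K, a'.IsHomogeneous i ∧
        l ^ (n - i - (i + m)) * (a - l ^ m * a') ∈ I := by
    intro m
    induction m with
    | zero =>
      intro _ a ha
      exact ⟨a, ha, by simp⟩
    | succ m ih =>
      intro hm a ha
      obtain ⟨c, hc, j, hj, hcj⟩ := Submodule.mem_sup.1 (hcov _ ha)
      obtain ⟨p, hp, q, hq, hpq⟩ := Submodule.mem_sup.1 (show j ∈ I ⊔ Ideal.span {l} from hj)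
      obtain ⟨g, rfl⟩ := Ideal.mem_span_singleton.1 hq
      obtain ⟨a', ha', h⟩ := ih (by omega) (homogeneousComponent (i + m) g)
        (homogeneousComponent_isHomogeneous _ _)
      refine ⟨a', ha', ?_⟩
      have e1 : a = c + homogeneousComponent (i + (m + 1)) p + l * homogeneousComponent (i + m) g := by
        rw [← hcomp_mul hl, ← homogeneousComponent_eq_self (hC _ hc),
          ← homogeneousComponent_eq_self ha, ← hcj, ← hpq, map_add, map_add,
          show 1 + (i + m) = i + (m + 1) by ring, homogeneousComponent_eq_self (hC _ hc)]
        ring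
      have e2 : n - i - (i + m) = n - i - (i + (m + 1)) + 1 := by omega
      have h1 := hI p hp (i + (m + 1))
      obtain ⟨r, hr⟩ := Nat.exists_eq_add_of_le
        (show n + 1 - 2 * (i + (m + 1)) ≤ n - i - (i + (m + 1)) by omega)
      have h2 := hnil _ c hc
      have e3 : l ^ (n - i - (i + (m + 1))) * (a - l ^ (m + 1) * a') =
          l ^ r * (l ^ (n + 1 - 2 * (i + (m + 1))) * c) +
          l ^ (n - i - (i + (m + 1))) * homogeneousComponent (i + (m + 1)) p +
          l ^ (n - i - (i + m)) * (homogeneousComponent (i + m) g - l ^ m * a') := by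
        rw [e2]
        conv_lhs => rw [e1]
        rw [← mul_assoc (l ^ r), ← pow_add, add_comm r, ← hr]
        ring
      rw [e3]
      exact I.add_mem (I.add_mem (I.mul_mem_left _ h2) (I.mul_mem_left _ h1)) h
  obtain ⟨a', h1, h2⟩ := key (n - 2 * i) (by omega) a (by
    rwa [show i + (n - 2 * i) = n - i by omega])
  refine ⟨a', h1, ?_⟩
  rwa [show n - i - (i + (n - 2 * i)) = 0 by omega, pow_zero, one_mul] at h2

theorem bij_of_surj {K : Type*} [Field K] {n : ℕ} {I : Ideal (MvPolynomial (Fin n) K)}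
    (hilb : ∀ d, Module.finrank K (qdeg I d) = n.choose d)
    {l : MvPolynomial (Fin n) K} (hl : l.IsHomogeneous 1)
    (hs : ∀ i, 2 * i ≤ n → ∀ a : MvPolynomial (Fin n) K, a.IsHomogeneous (n - i) →
      ∃ a' : MvPolynomial (Fin n) K, a'.IsHomogeneous i ∧ a - l ^ (n - 2 * i) * a' ∈ I)
    (i : ℕ) (hi : i ≤ n / 2) :
    Set.BijOn (fun a => (Ideal.Quotient.mkₐ K I) l ^ (n - 2 * i) * a) (qdeg I i)
      (qdeg I (n - i)) := by
  have hi2 : 2 * i ≤ n := by omega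
  have hmaps : ∀ a ∈ qdeg I i, (LinearMap.mulLeft K ((Ideal.Quotient.mkₐ K I) l ^ (n - 2 * i))) a
      ∈ qdeg I (n - i) := by
    rintro _ ⟨a, ha, rfl⟩
    refine ⟨l ^ (n - 2 * i) * a, ?_, ?_⟩
    · have := (hl.pow (n - 2 * i)).mul ha
      rw [show 1 * (n - 2 * i) + i = n - i by omega] at this
      exact this
    · simp
  have hsurj : ∀ b ∈ qdeg I (n - i), ∃ a ∈ qdeg I i,
      (Ideal.Quotient.mkₐ K I) l ^ (n - 2 * i) * a = b := by
    rintro _ ⟨b, hb, rfl⟩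
    obtain ⟨a', h1, h2⟩ := hs i hi2 b hb
    refine ⟨_, ⟨a', h1, rfl⟩, ?_⟩
    have : Ideal.Quotient.mk I b = Ideal.Quotient.mk I (l ^ (n - 2 * i) * a') :=
      Ideal.Quotient.eq.2 h2
    rw [map_mul, map_pow] at this
    exact this.symm
  let F : qdeg I i →ₗ[K] qdeg I (n - i) :=
    (LinearMap.mulLeft K ((Ideal.Quotient.mkₐ K I) l ^ (n - 2 * i))).restrict hmaps
  have hF : Function.Surjective F := by
    rintro ⟨b, hb⟩
    obtain ⟨a, ha, hab⟩ := hsurj b hb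
    exact ⟨⟨a, ha⟩, Subtype.ext hab⟩
  have hFi : Function.Injective F := by
    refine (LinearMap.injective_iff_surjective_of_finrank_eq_finrank ?_).2 hF
    rw [hilb, hilb, Nat.choose_symm (by omega)]
  refine ⟨hmaps, ?_, ?_⟩
  · intro a ha b hb hab
    have := @hFi ⟨a, ha⟩ ⟨b, hb⟩ (Subtype.ext hab)
    exact congrArg Subtype.val this
  · intro b hb
    obtain ⟨a, ha, hab⟩ := hsurj b hb
    exact ⟨a, ha, hab⟩

theorem no_zero {K L : Type*} [Field K] [Field L] [Algebra K L] {n : ℕ}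
    (f : Fin n → MvPolynomial (Fin n) K)
    (hilb : ∀ d, Module.finrank K (qdeg (Ideal.span (Set.range f)) d) = n.choose d)
    (v : Fin n → L) (hv : ∀ i, aeval v (f i) = 0) (i : Fin n) : v i = 0 := by
  have h := hilb (n + 1)
  rw [Nat.choose_succ_self] at h
  rw [Submodule.finrank_eq_zero] at h
  have h1 : Ideal.Quotient.mk (Ideal.span (Set.range f)) (X i ^ (n + 1)) = 0 := by
    have : Ideal.Quotient.mk (Ideal.span (Set.range f)) (X i ^ (n + 1)) ∈
        qdeg (Ideal.span (Set.range f)) (n + 1) := ⟨_, isHomogeneous_X_pow i (n + 1), rfl⟩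
    rwa [h, Submodule.mem_bot] at this
  rw [Ideal.Quotient.eq_zero_iff_mem] at h1
  have h2 : Ideal.span (Set.range f) ≤ RingHom.ker (aeval v : MvPolynomial (Fin n) K →ₐ[K] L) := by
    rw [Ideal.span_le]
    rintro _ ⟨j, rfl⟩
    exact hv j
  have h3 : aeval v (X i ^ (n + 1) : MvPolynomial (Fin n) K) = 0 := h2 h1
  rw [map_pow, aeval_X] at h3
  exact pow_eq_zero_iff (Nat.succ_ne_zero n) |>.1 h3

theorem mul_prod_congr {S ι : Type*} [CommRing S] (δ : S) (s : Finset ι) (A B : ι → S)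
    (h : ∀ j ∈ s, δ * A j = δ * B j) : δ * ∏ j ∈ s, A j = δ * ∏ j ∈ s, B j := by
  classical
  induction s using Finset.induction_on with
  | empty => simp
  | insert a s ha ih =>
    rw [Finset.prod_insert ha, Finset.prod_insert ha]
    have h1 := h a (Finset.mem_insert_self a s)
    have h2 := ih fun j hj => h j (Finset.mem_insert_of_mem hj)
    linear_combination (∏ j ∈ s, A j) * h1 + B a * h2

end Skeleton

section CaseA

theorem nilA {L S : Type*} [Field L] [CommRing S] [Algebra L S] {n : ℕ} (x : Fin n → S) (r s : L)
    (hx : ∀ i, x i ^ 2 = algebraMap L S (r + s) * (∑ j, x j) * x i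
      - algebraMap L S (r * s) * (∑ j, x j) ^ 2)
    (hrs : ∀ j k : ℕ, j + k = n → (j : L) * r + k * s ≠ 1)
    {k : ℕ} {V : Finset (Fin n)} {δ : S} (h : Spe x k V δ) :
    (∑ j, x j) ^ (n + 1 - 2 * k) * δ = 0 := by
  set E := ∑ j, x j with hE
  have hsum := h.sum_mul (algebraMap L S (r + s) * E) (- (algebraMap L S (r * s) * E ^ 2))
    (fun i => by rw [hx i]; ring)
  have hV := h.card
  have hc : Vᶜ.card = n - 2 * k := by rw [Finset.card_compl, hV, Fintype.card_fin]
  have hkn : 2 * k ≤ n := by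
    rw [← hV]; simpa using Finset.card_le_univ V
  have hf := falling (algebraMap L S (s - r) * E) (fun i => x i - algebraMap L S r * E)
    (fun i => by
      have := hx i
      simp only [map_add, map_mul, map_sub] at this ⊢
      linear_combination this) Vᶜ
  rw [hc] at hf
  have hcomp : ∑ i ∈ Vᶜ, x i = E - ∑ i ∈ V, x i := by
    rw [hE, ← Finset.sum_compl_add_sum V]; ring
  have h1 := mul_prod_congr δ (Finset.range (n - 2 * k + 1))
    (fun j => ∑ i ∈ Vᶜ, (x i - algebraMap L S r * E) - j * (algebraMap L S (s - r) * E))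
    (fun j => algebraMap L S (1 - k * (r + s) - (n - 2 * k : ℕ) * r - j * (s - r)) * E)
    (fun j _ => by
      rw [Finset.sum_sub_distrib, Finset.sum_const, hc, hcomp, nsmul_eq_mul]
      simp only [map_add, map_mul, map_sub, map_natCast, map_one] at hsum ⊢
      linear_combination -hsum)
  rw [hf, mul_zero, Finset.prod_mul_distrib, Finset.prod_const, Finset.card_range,
    ← map_prod] at h1
  set c := ∏ j ∈ Finset.range (n - 2 * k + 1),
    (1 - k * (r + s) - (n - 2 * k : ℕ) * r - j * (s - r)) with hcdef
  have hc0 : c ≠ 0 := by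
    rw [hcdef, Finset.prod_ne_zero_iff]
    intro j hj h0
    rw [Finset.mem_range] at hj
    refine hrs (k + (n - 2 * k - j)) (k + j) (by omega) ?_
    have : ((n - 2 * k : ℕ) : L) = ((n - 2 * k - j : ℕ) : L) + j := by
      rw [← Nat.cast_add]; congr 1; omega
    rw [this] at h0
    push_cast
    linear_combination -h0
  have h2 : algebraMap L S c⁻¹ * algebraMap L S c = 1 := by
    rw [← map_mul, inv_mul_cancel₀ hc0, map_one]
  rw [show n + 1 - 2 * k = n - 2 * k + 1 by omega]
  linear_combination (-algebraMap L S c⁻¹) * h1 - δ * E ^ (n - 2 * k + 1) * h2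

theorem base_change.{u} (K L A : Type u) [Field K] [Field L] [Algebra K L] [CommRing A] [Algebra K A] :
    ∃ (S : Type u) (_ : CommRing S) (_ : Algebra L S) (ψ : A →+* S), Function.Injective ψ ∧
      ∀ t : K, ψ (algebraMap K A t) = algebraMap L S (algebraMap K L t) := by
  refine ⟨TensorProduct K L A, inferInstance, inferInstance,
    (Algebra.TensorProduct.includeRight : A →ₐ[K] TensorProduct K L A).toRingHom,
    Algebra.TensorProduct.includeRight_injective (algebraMap K L).injective, fun t => ?_⟩
  change (Algebra.TensorProduct.includeRight : A →ₐ[K] TensorProduct K L A) _ = _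
  rw [AlgHom.commutes, ← IsScalarTower.algebraMap_apply]

theorem caseA {K : Type*} [Field K] [CharZero K] {n : ℕ} {I : Ideal (MvPolynomial (Fin n) K)}
    (hI : HomIdeal I) (b c : K)
    (hx : ∀ i, (X i ^ 2 - C b * (∑ j, X j) * X i - C c * (∑ j, X j) ^ 2 : MvPolynomial (Fin n) K) ∈ I)
    (hrs : ∀ r s : AlgebraicClosure K, r + s = algebraMap K _ b → r * s = - algebraMap K _ c →
      ∀ j k : ℕ, j + k = n → (j : AlgebraicClosure K) * r + k * s ≠ 1)
    (i : ℕ) (hi : 2 * i ≤ n) (a : MvPolynomial (Fin n) K) (ha : a.IsHomogeneous (n - i)) :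
    ∃ a' : MvPolynomial (Fin n) K, a'.IsHomogeneous i ∧
      a - (∑ j, X j) ^ (n - 2 * i) * a' ∈ I := by
  have hX : ∀ i : Fin n, (X i : MvPolynomial (Fin n) K).IsHomogeneous 1 := isHomogeneous_X K
  have he : (∑ j, X j : MvPolynomial (Fin n) K).IsHomogeneous 1 :=
    IsHomogeneous.sum _ _ _ fun i _ => hX i
  refine skeleton hI he (fun d => PSp K (X : Fin n → MvPolynomial (Fin n) K) d) ?_ ?_ ?_ i hi a ha
  · intro d
    rw [PSp, Submodule.span_le]
    rintro δ ⟨V, hδ⟩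
    exact hδ.homog hX
  · intro d
    set J := I ⊔ Ideal.span {(∑ j, X j : MvPolynomial (Fin n) K)} with hJ
    have heJ : (∑ j, X j : MvPolynomial (Fin n) K) ∈ J :=
      Ideal.mem_sup_right (Ideal.mem_span_singleton_self _)
    have hsq : ∀ i, (X i ^ 2 : MvPolynomial (Fin n) K) ∈ J := by
      intro i
      have h1 : _ ∈ J := Ideal.mem_sup_left (hx i)
      have h2 := J.add_mem h1 (J.mul_mem_left (C b * X i + C c * (∑ j, X j)) heJ)
      convert h2 using 1
      ring
    refine (cover (X : Fin n → MvPolynomial (Fin n) K) J hsq (fun i => Submodule.mem_sup_left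
      (Submodule.subset_span ⟨i, rfl⟩)) d).trans ?_
    refine sup_le ((zsp_le _ J hsq d).trans ?_) le_sup_right
    refine sup_le (sup_le le_sup_left ?_) le_sup_right
    rintro _ ⟨z, _, rfl⟩
    exact Submodule.mem_sup_right (J.mul_mem_right z heJ)
  · intro d c' hc'
    induction hc' using Submodule.span_induction with
    | zero => simp
    | add p q _ _ hp hq => rw [mul_add]; exact I.add_mem hp hq
    | smul t p _ hp => rw [mul_smul_comm]; exact Submodule.smul_of_tower_mem I t hp
    | mem δ hδ =>
      obtain ⟨V, hδ⟩ := hδ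
      obtain ⟨D, hD⟩ := IsAlgClosed.exists_pow_nat_eq
        (algebraMap K (AlgebraicClosure K) (b ^ 2 + 4 * c)) (n := 2) (by norm_num)
      set r := (algebraMap K (AlgebraicClosure K) b + D) / 2 with hr
      set s := (algebraMap K (AlgebraicClosure K) b - D) / 2 with hs
      have h1 : r + s = algebraMap K _ b := by rw [hr, hs]; ring
      have h2 : r * s = - algebraMap K _ c := by
        rw [hr, hs]
        simp only [map_add, map_pow, map_mul, map_ofNat] at hD
        linear_combination (-1/4 : AlgebraicClosure K) * hD
      obtain ⟨S, _, _, ψ, hψ, hψC⟩ := base_change K (AlgebraicClosure K)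
        (MvPolynomial (Fin n) K ⧸ I)
      let φ : MvPolynomial (Fin n) K →+* S := ψ.comp (Ideal.Quotient.mk I)
      have hφ : ∀ p, φ p = 0 ↔ p ∈ I := by
        intro p
        change ψ (Ideal.Quotient.mk I p) = 0 ↔ _
        rw [map_eq_zero_iff ψ hψ, Ideal.Quotient.eq_zero_iff_mem]
      have hφC : ∀ t : K, φ (C t) =
          algebraMap (AlgebraicClosure K) S (algebraMap K (AlgebraicClosure K) t) := fun t => hψC t
      rw [← hφ, map_mul, map_pow, map_sum]
      refine nilA (fun i => φ (X i)) r s ?_ (hrs r s h1 h2) (hδ.map φ)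
      intro i
      have h3 := (hφ _).2 (hx i)
      rw [map_sub, map_sub, map_mul, map_mul, map_mul, map_pow, map_pow, hφC, hφC, map_sum] at h3
      rw [h1, h2, map_neg]
      linear_combination h3

end CaseA
section CaseB

theorem sum_odd {K : Type*} [Field K] [CharZero K] (m : ℕ) :
    ∑ j ∈ Finset.range (2 * m + 1), (((2 * (m : ℤ) - 2 * j - 1 : ℤ) : K))⁻¹ =
      - (((2 * m + 1 : ℕ) : K))⁻¹ := by
  induction m with
  | zero => norm_num
  | succ m ih =>
    rw [show 2 * (m + 1) + 1 = (2 * m + 1) + 1 + 1 by ring, Finset.sum_range_succ,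
      Finset.sum_range_succ']
    have : ∀ j ∈ Finset.range (2 * m + 1),
        (((2 * ((m + 1 : ℕ) : ℤ) - 2 * ((j + 1 : ℕ) : ℤ) - 1 : ℤ) : K))⁻¹ =
        (((2 * (m : ℤ) - 2 * j - 1 : ℤ) : K))⁻¹ := by
      intro j _
      congr 2
      push_cast
      ring
    rw [Finset.sum_congr rfl this, ih]
    have h1 : (((2 * ((m + 1 : ℕ) : ℤ) - 2 * ((0 : ℕ) : ℤ) - 1 : ℤ) : K)) = ((2 * m + 1 : ℕ) : K) := by
      push_cast
      ring
    have h2 : (((2 * ((m + 1 : ℕ) : ℤ) - 2 * ((2 * m + 1 + 1 : ℕ) : ℤ) - 1 : ℤ) : K)) =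
        - ((2 * m + 1 + 1 + 1 : ℕ) : K) := by
      push_cast
      ring
    rw [h1, h2, inv_neg]
    ring

theorem prod_nil {S : Type*} [CommRing S] (t e : S) (he : e ^ 2 = 0) (g : ℕ → S) (M : ℕ) :
    ∏ j ∈ Finset.range (M + 1), (t + g j * e) =
      t ^ (M + 1) + (∑ j ∈ Finset.range (M + 1), g j) * t ^ M * e := by
  induction M with
  | zero => simp
  | succ M ih =>
    rw [Finset.prod_range_succ, ih, Finset.sum_range_succ _ (M + 1)]
    linear_combination (∑ j ∈ Finset.range (M + 1), g j) * t ^ M * g (M + 1) * he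

theorem nilB {K S : Type*} [Field K] [CharZero K] [CommRing S] [Algebra K S] {m₀ : ℕ}
    (y : Fin (2 * m₀) → S) (t e : S) (κ μ : K) (he : e ^ 2 = 0)
    (hy : ∀ i, y i ^ 2 = (t - algebraMap K S μ * e) ^ 2)
    (hsum : ∑ i, y i = algebraMap K S (κ + μ) * e - t)
    {k : ℕ} {V : Finset (Fin (2 * m₀))} {δ : S} (h : Spe y k V δ) :
    t ^ (2 * m₀ - 2 * k) * ((t - algebraMap K S (κ * ((2 * (m₀ : ℤ) - 2 * k + 1 : ℤ) : K)⁻¹ +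
      ((2 * (m₀ : ℤ) - 2 * k + 1 : ℤ) : K) * μ) * e) * δ) = 0 := by
  have hV := h.card
  have hkn : 2 * k ≤ 2 * m₀ := by
    rw [← hV]; simpa using Finset.card_le_univ V
  obtain ⟨m, rfl⟩ : ∃ m, m₀ = k + m := Nat.exists_eq_add_of_le (by omega)
  have hc : Vᶜ.card = 2 * m := by rw [Finset.card_compl, hV, Fintype.card_fin]; omega
  have h1 := h.sum_mul 0 _ (fun i => by rw [hy i, zero_mul, zero_add])
  set θ := t - algebraMap K S μ * e with hθ
  have hf := falling (2 * θ) (fun i => y i + θ) (fun i => by linear_combination hy i) Vᶜ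
  rw [hc] at hf
  have hcomp : ∑ i ∈ Vᶜ, y i = algebraMap K S (κ + μ) * e - t - ∑ i ∈ V, y i := by
    rw [← hsum, ← Finset.sum_compl_add_sum V]; ring
  let hh : ℕ → K := fun j => ((2 * (m : ℤ) - 2 * j - 1 : ℤ) : K)
  have hh0 : ∀ j, hh j ≠ 0 := by
    intro j h0
    simp only [hh, Int.cast_eq_zero] at h0
    omega
  have h2 := mul_prod_congr δ (Finset.range (2 * m + 1))
    (fun j => ∑ i ∈ Vᶜ, (y i + θ) - j * (2 * θ))
    (fun j => algebraMap K S (hh j) * (t + algebraMap K S (κ * (hh j)⁻¹ - μ) * e))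
    (fun j _ => by
      have h3 : algebraMap K S (hh j) * algebraMap K S (κ * (hh j)⁻¹ - μ) =
          algebraMap K S (κ - hh j * μ) := by
        rw [← map_mul]
        congr 1
        have := mul_inv_cancel₀ (hh0 j)
        linear_combination κ * this
      have h4 : algebraMap K S (hh j) = 2 * (m : S) - 2 * j - 1 := by
        simp only [hh, map_intCast]
        push_cast
        ring
      rw [mul_add (algebraMap K S (hh j)), ← mul_assoc (algebraMap K S (hh j)) _ e, h3, map_sub, map_mul, h4, Finset.sum_add_distrib,
        Finset.sum_const, hc, hcomp, nsmul_eq_mul, hθ]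
      rw [map_add]
      push_cast
      linear_combination -h1)
  rw [hf, mul_zero, Finset.prod_mul_distrib, prod_nil t e he, ← map_prod, ← map_sum,
    Finset.sum_sub_distrib, ← Finset.mul_sum, sum_odd, Finset.sum_const, Finset.card_range,
    nsmul_eq_mul] at h2
  set c := ∏ j ∈ Finset.range (2 * m + 1), hh j with hcdef
  have hc0 : c ≠ 0 := Finset.prod_ne_zero_iff.2 fun j _ => hh0 j
  have h3 : algebraMap K S c⁻¹ * algebraMap K S c = 1 := by
    rw [← map_mul, inv_mul_cancel₀ hc0, map_one]
  have h5 : ((2 * ((k + m : ℕ) : ℤ) - 2 * k + 1 : ℤ) : K) = ((2 * m + 1 : ℕ) : K) := by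
    push_cast; ring
  rw [h5, show 2 * (k + m) - 2 * k = 2 * m by omega]
  set q : K := ((2 * m + 1 : ℕ) : K)
  have h6 : algebraMap K S (κ * -q⁻¹ - q * μ) = - algebraMap K S (κ * q⁻¹ + q * μ) := by
    rw [← map_neg]; congr 1; ring
  rw [h6] at h2
  linear_combination (-algebraMap K S c⁻¹) * h2 -
    δ * (t ^ (2 * m + 1) + -algebraMap K S (κ * q⁻¹ + q * μ) * t ^ (2 * m) * e) * h3


theorem caseB {K : Type*} [Field K] [CharZero K] {m₀ : ℕ}
    {I : Ideal (MvPolynomial (Fin (2 * m₀ + 1)) K)} (hI : HomIdeal I) (b : K)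
    (he : (∑ j, X j : MvPolynomial (Fin (2 * m₀ + 1)) K) ^ 2 ∈ I)
    (hy : ∀ i j, ((X i + C b * ∑ k, X k) ^ 2 - (X j + C b * ∑ k, X k) ^ 2 :
      MvPolynomial (Fin (2 * m₀ + 1)) K) ∈ I) :
    ∃ l : MvPolynomial (Fin (2 * m₀ + 1)) K, l.IsHomogeneous 1 ∧
    ∀ i : ℕ, 2 * i ≤ 2 * m₀ + 1 → ∀ a : MvPolynomial (Fin (2 * m₀ + 1)) K,
      a.IsHomogeneous (2 * m₀ + 1 - i) →
      ∃ a' : MvPolynomial (Fin (2 * m₀ + 1)) K, a'.IsHomogeneous i ∧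
        a - l ^ (2 * m₀ + 1 - 2 * i) * a' ∈ I := by
  have hX1 : ∀ i : Fin (2 * m₀ + 1), (X i : MvPolynomial (Fin (2 * m₀ + 1)) K).IsHomogeneous 1 :=
    isHomogeneous_X K
  have he1 : (∑ j, X j : MvPolynomial (Fin (2 * m₀ + 1)) K).IsHomogeneous 1 :=
    IsHomogeneous.sum _ _ _ fun i _ => hX1 i
  have hesum : (∑ j, X j : MvPolynomial (Fin (2 * m₀ + 1)) K) =
    ∑ i : Fin (2 * m₀), X (Fin.castSucc i) + X (Fin.last (2 * m₀)) := Fin.sum_univ_castSucc _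
  set e := (∑ j, X j : MvPolynomial (Fin (2 * m₀ + 1)) K) with hedef
  set κ : K := 1 + (2 * m₀ + 1) * b with hκ
  obtain ⟨μ, hμ1, hμ2⟩ : ∃ μ : K, κ + μ ≠ 0 ∧ ∀ q : K, q ≠ 0 → κ * q⁻¹ + q * μ ≠ 0 := by
    by_cases h : κ = 0
    · exact ⟨1, by simp [h], fun q hq => by simpa [h] using hq⟩
    · exact ⟨0, by simpa using h, fun q hq => by simp [h, hq]⟩
  set y : Fin (2 * m₀) → MvPolynomial (Fin (2 * m₀ + 1)) K :=
    fun i => X (Fin.castSucc i) + C b * e with hydef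
  set t := X (Fin.last (2 * m₀)) + C b * e + C μ * e with ht
  have hCe : ∀ s : K, (C s * e).IsHomogeneous 1 := by
    intro s
    have := (isHomogeneous_C (Fin (2 * m₀ + 1)) s).mul he1
    simpa using this
  have hy1 : ∀ i, (y i).IsHomogeneous 1 := fun i => (hX1 _).add (hCe b)
  have ht1 : t.IsHomogeneous 1 := ((hX1 _).add (hCe b)).add (hCe μ)
  have hsum : ∑ i, y i = C (κ + μ) * e - t := by
    simp only [hydef, Finset.sum_add_distrib, Finset.sum_const, Finset.card_univ,
      Fintype.card_fin, nsmul_eq_mul]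
    rw [ht, hκ]
    simp only [map_add, map_mul, map_one, map_natCast, map_ofNat]
    push_cast
    linear_combination -hesum
  let q : ℕ → K := fun d => ((2 * (m₀ : ℤ) - 2 * d + 1 : ℤ) : K)
  have hq : ∀ d, q d ≠ 0 := by
    intro d h0
    simp only [q, Int.cast_eq_zero] at h0
    omega
  let G : ℕ → K := fun d => κ * (q d)⁻¹ + q d * μ
  have hG : ∀ d, G d ≠ 0 := fun d => hμ2 _ (hq d)
  have hP1 : ∀ d, PSp K y d ≤ homogeneousSubmodule (Fin (2 * m₀ + 1)) K d := by
    intro d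
    rw [PSp, Submodule.span_le]
    rintro δ ⟨V, hδ⟩
    exact hδ.homog hy1
  have hlast : ∀ i, y i ^ 2 - (t - C μ * e) ^ 2 ∈ I := by
    intro i
    have := hy (Fin.castSucc i) (Fin.last _)
    convert this using 2
    rw [ht]; ring
  have hN0 : ∀ d V δ, Spe y d V δ → t ^ (2 * m₀ - 2 * d) * ((t - C (G d) * e) * δ) ∈ I := by
    intro d V δ hδ
    rw [← Ideal.Quotient.eq_zero_iff_mem]
    have h1 := nilB (K := K) (fun i => Ideal.Quotient.mk I (y i)) (Ideal.Quotient.mk I t)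
      (Ideal.Quotient.mk I e) κ μ
      (by rw [← map_pow, Ideal.Quotient.eq_zero_iff_mem]; exact he)
      (fun i => Ideal.Quotient.eq.2 (hlast i))
      (by rw [← map_sum, hsum, map_sub, map_mul]; rfl)
      (hδ.map (Ideal.Quotient.mk I))
    rw [map_mul, map_pow, map_mul, map_sub, map_mul]
    exact h1
  have hN1 : ∀ d, ∀ c ∈ PSp K y d, t ^ (2 * m₀ - 2 * d) * ((t - C (G d) * e) * c) ∈ I := by
    intro d c hc
    induction hc using Submodule.span_induction with
    | zero => simp
    | add p q _ _ hp hq => rw [mul_add, mul_add]; exact I.add_mem hp hq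
    | smul s p _ hp =>
      rw [mul_smul_comm, mul_smul_comm]; exact Submodule.smul_of_tower_mem I s hp
    | mem δ hδ =>
      obtain ⟨V, hδ⟩ := hδ
      exact hN0 d V δ hδ
  have hN2 : ∀ d, ∀ c ∈ PSp K y d, t ^ (2 * m₀ + 1 + 1 - 2 * d) * c ∈ I := by
    intro d c hc
    induction hc using Submodule.span_induction with
    | zero => simp
    | add p q _ _ hp hq => rw [mul_add]; exact I.add_mem hp hq
    | smul s p _ hp =>
      rw [mul_smul_comm]; exact Submodule.smul_of_tower_mem I s hp
    | mem δ hδ =>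
      obtain ⟨V, hδ⟩ := hδ
      have h1 : 2 * d ≤ 2 * m₀ := by
        rw [← hδ.card]; simpa using Finset.card_le_univ V
      rw [show 2 * m₀ + 1 + 1 - 2 * d = 2 * m₀ - 2 * d + 2 by omega]
      have h2 := I.add_mem (I.mul_mem_left (t + C (G d) * e) (hN0 d V δ hδ))
        (I.mul_mem_left (C (G d) ^ 2 * t ^ (2 * m₀ - 2 * d) * δ) he)
      convert h2 using 1
      ring
  refine ⟨t, ht1, skeleton hI ht1 (fun d => PSp K y d ⊔ (match d with
    | 0 => ⊥
    | d + 1 => (PSp K y d).map (LinearMap.mulLeft K (t - C (G d) * e)))) ?_ ?_ ?_⟩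
  · intro d
    refine sup_le (hP1 d) ?_
    rcases d with _ | d
    · exact bot_le
    · rintro _ ⟨p, hp, rfl⟩
      have := (ht1.sub (hCe (G d))).mul (hP1 d hp)
      rw [add_comm 1 d] at this
      exact this
  · intro d
    set J := I ⊔ Ideal.span {t} with hJ
    have htJ : t ∈ J := Ideal.mem_sup_right (Ideal.mem_span_singleton_self _)
    have heJ : e ^ 2 ∈ J := Ideal.mem_sup_left he
    have hsq : ∀ i, y i ^ 2 ∈ J := by
      intro i
      have h1 : _ ∈ J := Ideal.mem_sup_left (hlast i)
      have h2 := J.add_mem h1 (J.add_mem (J.mul_mem_left (t - 2 * C μ * e) htJ)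
        (J.mul_mem_left (C μ ^ 2) heJ))
      convert h2 using 1
      ring
    have heS : e ∈ Submodule.span K (Set.range y) ⊔ J.restrictScalars K := by
      have h1 : e = (κ + μ)⁻¹ • (∑ i, y i) + C (κ + μ)⁻¹ * t := by
        have h3 : (C (κ + μ)⁻¹ : MvPolynomial (Fin (2 * m₀ + 1)) K) * C (κ + μ) = 1 := by
          rw [← map_mul, inv_mul_cancel₀ hμ1, map_one]
        rw [hsum, smul_eq_C_mul]
        linear_combination -e * h3
      rw [h1]
      exact Submodule.add_mem _ (Submodule.mem_sup_left (Submodule.smul_mem _ _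
        (Submodule.sum_mem _ fun i _ => Submodule.subset_span ⟨i, rfl⟩)))
        (Submodule.mem_sup_right (J.mul_mem_left _ htJ))
    have hXS : ∀ i, X i ∈ Submodule.span K (Set.range y) ⊔ J.restrictScalars K := by
      intro i
      induction i using Fin.lastCases with
      | last =>
        have : (X (Fin.last (2 * m₀)) : MvPolynomial (Fin (2 * m₀ + 1)) K) = t - (b + μ) • e := by
          rw [ht, smul_eq_C_mul, map_add]; ring
        rw [this]
        exact Submodule.sub_mem _ (Submodule.mem_sup_right htJ) (Submodule.smul_mem _ _ heS)
      | cast i =>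
        have : (X (Fin.castSucc i) : MvPolynomial (Fin (2 * m₀ + 1)) K) = y i - b • e := by
          rw [hydef, smul_eq_C_mul]; ring
        rw [this]
        exact Submodule.sub_mem _ (Submodule.mem_sup_left (Submodule.subset_span ⟨i, rfl⟩))
          (Submodule.smul_mem _ _ heS)
    refine (cover y J hsq hXS d).trans ?_
    rcases d with _ | d
    · refine sup_le_sup_right (le_trans ?_ le_sup_left) _
      rw [ZSp, Submodule.span_le]
      rintro _ ⟨k, V, δ, U, h, hUV, hk, rfl⟩
      obtain ⟨rfl, hU⟩ : k = 0 ∧ U.card = 0 := by omega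
      rw [Finset.card_eq_zero] at hU
      subst hU
      refine Submodule.subset_span ⟨V, ?_⟩
      simpa using h
    · refine sup_le ((zsp_le _ J hsq _).trans ?_) le_sup_right
      refine sup_le (sup_le (le_sup_left.trans le_sup_left) ?_) le_sup_right
      rintro _ ⟨z, hz, rfl⟩
      obtain ⟨w, hw, j, hj, hwj⟩ := Submodule.mem_sup.1 (zsp_le y J hsq d hz)
      obtain ⟨p, hp, _, ⟨z', hz', rfl⟩, hpz⟩ := Submodule.mem_sup.1 hw
      have h3 : (C (G d)⁻¹ : MvPolynomial (Fin (2 * m₀ + 1)) K) * C (G d) = 1 := by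
        rw [← map_mul, inv_mul_cancel₀ (hG d), map_one]
      have h4 : (LinearMap.mulLeft K (∑ i, y i)) z =
          (-((κ + μ) * (G d)⁻¹)) • ((LinearMap.mulLeft K (t - C (G d) * e)) p) +
          (t * ((C (κ + μ) * C (G d)⁻¹) * p - p) + (∑ i, y i) * j +
            (C (κ + μ) ^ 2 * z' * e ^ 2 + t * ((t - 2 * C (κ + μ) * e) * z'))) := by
        rw [← hwj, ← hpz]
        simp only [LinearMap.mulLeft_apply]
        rw [hsum, smul_eq_C_mul, map_neg, map_mul]
        linear_combination (-C (κ + μ) * e * p) * h3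
      rw [h4]
      refine Submodule.add_mem _ (Submodule.mem_sup_left (Submodule.mem_sup_right
        (Submodule.smul_mem _ _ ⟨p, hp, rfl⟩))) (Submodule.mem_sup_right ?_)
      exact J.add_mem (J.add_mem (J.mul_mem_right _ htJ) (J.mul_mem_left _ hj))
        (J.add_mem (J.mul_mem_left _ heJ) (J.mul_mem_right _ htJ))
  · intro d c hc
    obtain ⟨c₁, hc₁, c₂, hc₂, rfl⟩ := Submodule.mem_sup.1 hc
    rw [mul_add]
    refine I.add_mem ?_ ?_
    · exact hN2 d c₁ hc₁
    · rcases d with _ | d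
      · rw [(Submodule.mem_bot K).1 hc₂, mul_zero]; exact I.zero_mem
      · obtain ⟨p, hp, rfl⟩ := hc₂
        have := hN1 d p hp
        rw [show 2 * m₀ + 1 + 1 - 2 * (d + 1) = 2 * m₀ - 2 * d by omega]
        exact this

end CaseB
section NormalForm

theorem inv_const {α K : Type*} [Zero K] {m : ℕ} (g : (Fin m → α) → K)
    (hg : ∀ (σ : Equiv.Perm α) u, g (fun i => σ (u i)) = g u) :
    ∃ c, ∀ u, Function.Injective u → g u = c := by
  by_cases h : ∃ u : Fin m → α, Function.Injective u
  · obtain ⟨u, hu⟩ := h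
    refine ⟨g u, fun v hv => ?_⟩
    obtain ⟨σ, hσ⟩ := Equiv.Perm.exists_extending_pair u v hu hv
    rw [← hg σ u]
    congr 1
    funext i
    exact (hσ i).symm
  · exact ⟨0, fun u hu => absurd ⟨u, hu⟩ h⟩

theorem normal_form {K : Type*} [Field K] [CharZero K] {n : ℕ}
    (f : Fin n → MvPolynomial (Fin n) K)
    (hquad : ∀ i, (f i).IsHomogeneous 2)
    (hequiv : ∀ (σ : Equiv.Perm (Fin n)) (i : Fin n), rename σ (f i) = f (σ i)) :
    ∃ α β γ δ : K, (α ≠ 0 ∨ 3 ≤ n) ∧ ∀ i, f i = C α * X i ^ 2 + C β * X i * (∑ j, X j) +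
      C γ * (∑ j, X j ^ 2) + C δ * (∑ j, X j) ^ 2 := by
  let H : Fin n → Fin n → Fin n → K := fun i j k => constantCoeff (pderiv k (pderiv j (f i)))
  have hH : ∀ (σ : Equiv.Perm (Fin n)) i j k, H (σ i) (σ j) (σ k) = H i j k := by
    intro σ i j k
    simp only [H]
    rw [← hequiv, pderiv_rename σ.injective, pderiv_rename σ.injective, constantCoeff_rename]
  have h2f : ∀ i, 2 * f i = ∑ j, ∑ k, C (H i j k) * (X j * X k) := by
    intro i
    have h1 := (hquad i).sum_X_mul_pderiv
    have h2 : ∀ j, pderiv j (f i) = ∑ k, X k * C (H i j k) := by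
      intro j
      have h3 := (hquad i).pderiv (i := j)
      have h4 := h3.sum_X_mul_pderiv
      rw [show 2 - 1 = 1 from rfl, one_smul] at h4
      rw [← h4]
      refine Finset.sum_congr rfl fun k _ => ?_
      have h5 := h3.pderiv (i := k)
      rw [show 2 - 1 - 1 = 0 from rfl, ← totalDegree_zero_iff_isHomogeneous,
        totalDegree_eq_zero_iff_eq_C] at h5
      rw [h5]
      rfl
    rw [nsmul_eq_mul] at h1
    push_cast at h1
    rw [← h1]
    refine Finset.sum_congr rfl fun j _ => ?_
    rw [h2, Finset.mul_sum]
    refine Finset.sum_congr rfl fun k _ => ?_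
    ring
  obtain ⟨A, hA⟩ := inv_const (m := 1) (fun u => H (u 0) (u 0) (u 0)) (fun σ u => hH σ _ _ _)
  obtain ⟨B₁, hB₁⟩ := inv_const (m := 2) (fun u => H (u 0) (u 0) (u 1)) (fun σ u => hH σ _ _ _)
  obtain ⟨B₂, hB₂⟩ := inv_const (m := 2) (fun u => H (u 0) (u 1) (u 0)) (fun σ u => hH σ _ _ _)
  obtain ⟨E, hE⟩ := inv_const (m := 2) (fun u => H (u 0) (u 1) (u 1)) (fun σ u => hH σ _ _ _)
  have hinj2 : ∀ i j : Fin n, i ≠ j → Function.Injective ![i, j] := by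
    intro i j hij a b hab
    fin_cases a <;> fin_cases b <;> simp_all
  have hinj3 : ∀ i j k : Fin n, i ≠ j → i ≠ k → j ≠ k → Function.Injective ![i, j, k] := by
    intro i j k h1 h2 h3 a b hab
    fin_cases a <;> fin_cases b <;> simp_all
  obtain ⟨D, hD, hα⟩ : ∃ D, (∀ i j k : Fin n, i ≠ j → i ≠ k → j ≠ k → H i j k = D) ∧
      (A - E - B₁ - B₂ + 2 * D ≠ 0 ∨ 3 ≤ n) := by
    by_cases hn : 3 ≤ n
    · obtain ⟨D, hD⟩ := inv_const (m := 3) (fun u => H (u 0) (u 1) (u 2)) (fun σ u => hH σ _ _ _)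
      exact ⟨D, fun i j k h1 h2 h3 => hD ![i, j, k] (hinj3 i j k h1 h2 h3), Or.inr hn⟩
    · refine ⟨(1 - (A - E - B₁ - B₂)) / 2, fun i j k h1 h2 h3 => ?_, Or.inl ?_⟩
      · have := Fintype.card_le_of_injective _ (hinj3 i j k h1 h2 h3)
        simp only [Fintype.card_fin] at this
        exact absurd this hn
      · rw [show A - E - B₁ - B₂ + 2 * ((1 - (A - E - B₁ - B₂)) / 2) = 1 by ring]
        exact one_ne_zero
  have hval : ∀ i j k, H i j k = D + (if j = k then E - D else 0) + (if i = j then B₁ - D else 0) +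
      (if i = k then B₂ - D else 0) +
      (if i = j then (if i = k then A - E - B₁ - B₂ + 2 * D else 0) else 0) := by
    intro i j k
    by_cases h1 : i = j
    · subst h1
      by_cases h2 : i = k
      · subst h2
        have := hA ![i] (Function.injective_of_subsingleton _)
        simp only [Matrix.cons_val_zero] at this
        simp [this]
        ring
      · have := hB₁ ![i, k] (hinj2 i k h2)
        simp at this
        simp [this, h2]
    · by_cases h2 : i = k
      · subst h2
        have := hB₂ ![i, j] (hinj2 i j h1)
        simp at this
        simp [this, h1, Ne.symm h1]
      · by_cases h3 : j = k
        · subst h3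
          have := hE ![i, j] (hinj2 i j h1)
          simp at this
          simp [this, h1]
        · simp [hD i j k h1 h2 h3, h1, h2, h3]
  refine ⟨(A - E - B₁ - B₂ + 2 * D) / 2, (B₁ + B₂ - 2 * D) / 2, (E - D) / 2, D / 2, ?_, ?_⟩
  · refine hα.imp_left fun h => ?_
    exact div_ne_zero h two_ne_zero
  · intro i
    have h3 : ∑ j, ∑ k, C (H i j k) * (X j * X k) =
        C D * (∑ j, X j) ^ 2 + C (E - D) * (∑ j, X j ^ 2) + C (B₁ - D) * (X i * ∑ j, X j) +
          C (B₂ - D) * (X i * ∑ j, X j) + C (A - E - B₁ - B₂ + 2 * D) * X i ^ 2 := by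
      simp only [hval, map_add C, add_mul, Finset.sum_add_distrib, apply_ite C, C_0, ite_mul,
        zero_mul, Finset.sum_ite_eq, Finset.mem_univ, if_true, Finset.sum_ite_irrel,
        Finset.sum_const_zero, ← Finset.mul_sum, ← Finset.sum_mul, sq]
      ring
    have h4 := h2f i
    rw [h3] at h4
    have h5 : (C (1 / 2 : K) : MvPolynomial (Fin n) K) * 2 = 1 := by
      rw [← map_ofNat (C : K →+* MvPolynomial (Fin n) K), ← map_mul]
      norm_num
    have h6 : ∀ x : K, (C (x / 2) : MvPolynomial (Fin n) K) = C (1 / 2) * C x := by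
      intro x; rw [← map_mul]; congr 1; ring
    rw [h6 (A - E - B₁ - B₂ + 2 * D), h6 (B₁ + B₂ - 2 * D), h6 (E - D), h6 D]
    simp only [map_add, map_sub, map_mul, map_ofNat] at h4 ⊢
    linear_combination (C (1 / 2)) * h4 - f i * h5

end NormalForm
section Assembly

/-- surjectivity form of the strong Lefschetz property -/
def Surj {K : Type*} [Field K] {n : ℕ} (I : Ideal (MvPolynomial (Fin n) K))
    (l : MvPolynomial (Fin n) K) : Prop :=
  ∀ i, 2 * i ≤ n → ∀ a : MvPolynomial (Fin n) K, a.IsHomogeneous (n - i) →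
      ∃ a' : MvPolynomial (Fin n) K, a'.IsHomogeneous i ∧ a - l ^ (n - 2 * i) * a' ∈ I

theorem aeval_nf {K L : Type*} [Field K] [Field L] [Algebra K L] {n : ℕ} (α β γ δ : K)
    (v : Fin n → L) (i : Fin n) :
    aeval v (C α * X i ^ 2 + C β * X i * (∑ j, X j) +
      C γ * (∑ j, X j ^ 2) + C δ * (∑ j, X j) ^ 2 : MvPolynomial (Fin n) K) =
    algebraMap K L α * v i ^ 2 + algebraMap K L β * v i * (∑ j, v j) +
      algebraMap K L γ * (∑ j, v j ^ 2) + algebraMap K L δ * (∑ j, v j) ^ 2 := by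
  simp

theorem core {K : Type*} [Field K] [CharZero K] {n : ℕ}
    (f : Fin n → MvPolynomial (Fin n) K)
    (hI : HomIdeal (Ideal.span (Set.range f)))
    (hilb : ∀ d, Module.finrank K (qdeg (Ideal.span (Set.range f)) d) = n.choose d)
    (α β γ δ : K) (hα : α ≠ 0 ∨ 3 ≤ n)
    (hf : ∀ i, f i = C α * X i ^ 2 + C β * X i * (∑ j, X j) +
      C γ * (∑ j, X j ^ 2) + C δ * (∑ j, X j) ^ 2) :
    Surj (Ideal.span (Set.range f)) (∑ j, X j) ∨
    ((∑ j, X j : MvPolynomial (Fin n) K) ^ 2 ∈ Ideal.span (Set.range f) ∧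
      ∃ l : MvPolynomial (Fin n) K, l.IsHomogeneous 1 ∧ Surj (Ideal.span (Set.range f)) l) := by
  have hα0 : α ≠ 0 := by
    rcases hα with h | hn
    · exact h
    · rintro rfl
      obtain ⟨m, rfl⟩ := Nat.exists_eq_add_of_le' hn
      obtain ⟨D, hD⟩ := IsAlgClosed.exists_pow_nat_eq
        (-3 : AlgebraicClosure K) (n := 2) (by norm_num)
      set ω := (-1 + D) / 2 with hω
      have hω2 : 1 + (ω + ω ^ 2) = 0 := by
        rw [hω]; linear_combination (1 / 4 : AlgebraicClosure K) * hD
      let v : Fin (m + 3) → AlgebraicClosure K :=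
        Fin.cons 1 (Fin.cons ω (Fin.cons (ω ^ 2) (fun _ => 0)))
      have h1 : ∑ j, v j = 0 := by
        simp only [v, Fin.sum_univ_succ, Fin.cons_zero, Fin.cons_succ, Finset.sum_const_zero]
        linear_combination hω2
      have h2 : ∑ j, v j ^ 2 = 0 := by
        simp only [v, Fin.sum_univ_succ, Fin.cons_zero, Fin.cons_succ]
        simp only [ne_eq, OfNat.ofNat_ne_zero, not_false_eq_true, zero_pow,
          Finset.sum_const_zero]
        linear_combination (1 - ω + ω ^ 2) * hω2
      have h3 := no_zero f hilb v (fun i => by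
        rw [hf, aeval_nf, h1, h2]; simp) 0
      simp [v] at h3
  have hfI : ∀ i, f i ∈ Ideal.span (Set.range f) := fun i => Ideal.subset_span ⟨i, rfl⟩
  have hinv : (C α⁻¹ : MvPolynomial (Fin n) K) * C α = 1 := by
    rw [← map_mul, inv_mul_cancel₀ hα0, map_one]
  have hsumf : ∑ i, f i = C (α + n * γ) * (∑ j, X j ^ 2) + C (β + n * δ) * (∑ j, X j) ^ 2 := by
    simp only [hf, Finset.sum_add_distrib, ← Finset.mul_sum, ← Finset.sum_mul, Finset.sum_const,
      Finset.card_univ, Fintype.card_fin, nsmul_eq_mul, map_add, map_mul, map_natCast]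
    ring
  have hsumI : ∑ i, f i ∈ Ideal.span (Set.range f) := Ideal.sum_mem _ fun i _ => hfI i
  rw [hsumf] at hsumI
  by_cases h0 : α + n * γ = 0
  · right
    have hn0 : n ≠ 0 := by
      rintro rfl
      simp at h0
      exact hα0 h0
    have h1 : β + n * δ ≠ 0 := by
      intro h1
      have h3 := no_zero f hilb (fun _ => (1 : K)) (fun i => by
        rw [hf, aeval_nf]
        simp only [Finset.sum_const, Finset.card_univ, Fintype.card_fin, nsmul_eq_mul,
          Algebra.algebraMap_self, RingHom.id_apply]
        linear_combination h0 + n * h1) ⟨0, by omega⟩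
      exact one_ne_zero h3
    have he : (∑ j, X j : MvPolynomial (Fin n) K) ^ 2 ∈ Ideal.span (Set.range f) := by
      have h2 := Ideal.mul_mem_left _ (C (β + n * δ)⁻¹) hsumI
      have h3 : (C (β + n * δ)⁻¹ : MvPolynomial (Fin n) K) * C (β + n * δ) = 1 := by
        rw [← map_mul, inv_mul_cancel₀ h1, map_one]
      rw [h0, map_zero, zero_mul, zero_add, ← mul_assoc, h3, one_mul] at h2
      exact h2
    refine ⟨he, ?_⟩
    rcases Nat.even_or_odd' n with ⟨m, hm | hm⟩
    · exfalso
      have hs : ∑ j : Fin n, (-1 : K) ^ (j : ℕ) = 0 := by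
        rw [Fin.sum_univ_eq_sum_range (fun j => (-1 : K) ^ j), hm, neg_one_geom_sum]
        simp
      have hs2 : ∑ j : Fin n, ((-1 : K) ^ (j : ℕ)) ^ 2 = n := by
        simp [← pow_mul, mul_comm _ 2]
      have h3 := no_zero f hilb (fun j => (-1 : K) ^ (j : ℕ)) (fun i => by
        rw [hf, aeval_nf, hs, hs2]
        simp only [← pow_mul, mul_comm _ 2, Algebra.algebraMap_self, RingHom.id_apply]
        simp only [pow_mul, neg_one_sq, one_pow]
        linear_combination h0) ⟨0, by omega⟩
      simp at h3
    · subst hm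
      refine caseB hI (β / (2 * α)) he fun i j => ?_
      have h4 := Ideal.mul_mem_left _ (C α⁻¹) (Ideal.sub_mem _ (hfI i) (hfI j))
      convert h4 using 1
      have h5 : (2 : MvPolynomial (Fin (2 * m + 1)) K) * C (β / (2 * α)) = C α⁻¹ * C β := by
        rw [← map_ofNat (C : K →+* MvPolynomial (Fin (2 * m + 1)) K), ← map_mul, ← map_mul]
        congr 1
        field_simp
      rw [hf, hf]
      linear_combination (∑ k, X k) * (X i - X j) * h5 - (X i ^ 2 - X j ^ 2) * hinv
  · left
    set κ := -(β + n * δ) / (α + n * γ) with hκ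
    have hκ' : (α + n * γ) * κ = -(β + n * δ) := by rw [hκ]; field_simp
    have hp2 : (∑ j, X j ^ 2 - C κ * (∑ j, X j) ^ 2 : MvPolynomial (Fin n) K) ∈
        Ideal.span (Set.range f) := by
      have h2 := Ideal.mul_mem_left _ (C (α + n * γ)⁻¹) hsumI
      have h3 : (C (α + n * γ)⁻¹ : MvPolynomial (Fin n) K) * C (α + n * γ) = 1 := by
        rw [← map_mul, inv_mul_cancel₀ h0, map_one]
      have h4 : (C (α + n * γ) : MvPolynomial (Fin n) K) * C κ = - C (β + n * δ) := by
        rw [← map_mul, hκ', map_neg]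
      convert h2 using 1
      linear_combination (-(∑ j, X j ^ 2) + C κ * (∑ j, X j) ^ 2) * h3 -
        C (α + n * γ)⁻¹ * (∑ j, X j) ^ 2 * h4
    set b := -β / α with hb
    set c := -(γ * κ + δ) / α with hc
    have hb' : α * b = -β := by rw [hb]; field_simp
    have hc' : α * c = -(γ * κ + δ) := by rw [hc]; field_simp
    refine caseA hI b c ?_ ?_
    · intro i
      have h2 := Ideal.mul_mem_left _ (C α⁻¹) (Ideal.sub_mem _ (hfI i)
        (Ideal.mul_mem_left _ (C γ) hp2))
      have h3 : (C α : MvPolynomial (Fin n) K) * C b = - C β := by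
        rw [← map_mul, hb', map_neg]
      have h4 : (C α : MvPolynomial (Fin n) K) * C c = - (C γ * C κ + C δ) := by
        rw [← map_mul, hc', map_neg, map_add, map_mul]
      convert h2 using 1
      rw [hf]
      set e : MvPolynomial (Fin n) K := ∑ j, X j
      linear_combination (-(X i ^ 2) + C b * e * X i + C c * e ^ 2) * hinv -
        C α⁻¹ * e * X i * h3 - C α⁻¹ * e ^ 2 * h4
    · intro r s hr hs j k hjk h1
      set φ := algebraMap K (AlgebraicClosure K)
      let v : Fin n → AlgebraicClosure K := fun i => if (i : ℕ) < j then r else s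
      have hv : ∀ i, v i ^ 2 = φ b * v i + φ c := by
        intro i
        have h2 : φ c = - (r * s) := by rw [hs, neg_neg]
        rw [h2, ← hr]
        simp only [v]
        split_ifs <;> ring
      have hsum : ∑ i, v i = 1 := by
        rw [← h1]
        subst hjk
        rw [Fin.sum_univ_add]
        simp [v]
      have hsum2 : ∑ i, v i ^ 2 = φ b + n * φ c := by
        simp only [hv, Finset.sum_add_distrib, ← Finset.mul_sum, hsum]
        simp
      have h3 : b + n * c = κ := by
        apply mul_left_cancel₀ hα0
        linear_combination hb' + n * hc' - hκ'
      have h4 : φ b + n * φ c = φ κ := by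
        rw [← h3]; simp
      have h5 : φ α * φ b = - φ β := by rw [← map_mul, hb', map_neg]
      have h6 : φ α * φ c = -(φ γ * φ κ + φ δ) := by
        rw [← map_mul, hc', map_neg, map_add, map_mul]
      have h7 := no_zero f hilb v (fun i => by
        rw [hf, aeval_nf, hsum, hsum2, hv, h4]
        linear_combination v i * h5 + h6)
      simp [h7] at hsum

end Assembly

/-- Theorem 4.3 (main theorem): an Artinian complete intersection
`A = K[x₁,…,xₙ]/(f₁,…,fₙ)` defined by quadrics permuted by the `Sₙ`-action has
the strong Lefschetz property (the socle degree of `A` is `n`); moreover if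
`e₁² ∉ (f₁,…,fₙ)` then `e₁ = x₁+⋯+xₙ` is a strong Lefschetz element. -/
theorem quadratic_complete_intersection_SLP
    (K : Type*) [Field K] [CharZero K] (n : ℕ)
    (f : Fin n → MvPolynomial (Fin n) K)
    (hquad : ∀ i, (f i).IsHomogeneous 2)
    (hreg : RingTheory.Sequence.IsRegular (MvPolynomial (Fin n) K) (List.ofFn f))
    (hequiv : ∀ (σ : Equiv.Perm (Fin n)) (i : Fin n), rename σ (f i) = f (σ i))
    (I : Ideal (MvPolynomial (Fin n) K)) (hI : I = Ideal.span (Set.range f))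
    (π : MvPolynomial (Fin n) K →ₐ[K] (MvPolynomial (Fin n) K ⧸ I))
    (hπ : π = Ideal.Quotient.mkₐ K I)
    -- the grading of `A = R/I` by images of the homogeneous components
    (𝒜 : ℕ → Submodule K (MvPolynomial (Fin n) K ⧸ I))
    (h𝒜 : ∀ i, 𝒜 i = Submodule.map π.toLinearMap (homogeneousSubmodule (Fin n) K i)) :
    -- `A` has the strong Lefschetz property
    (∃ l ∈ homogeneousSubmodule (Fin n) K 1, ∀ i ≤ n / 2,
      Set.BijOn (fun a => π l ^ (n - 2 * i) * a) (𝒜 i) (𝒜 (n - i))) ∧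
    -- if `e₁² ∉ I` then `e₁` is a strong Lefschetz element
    ((∑ j, X j : MvPolynomial (Fin n) K) ^ 2 ∉ I → ∀ i ≤ n / 2,
      Set.BijOn (fun a => π (∑ j, X j) ^ (n - 2 * i) * a) (𝒜 i) (𝒜 (n - i))) := by
  subst hI
  subst hπ
  obtain ⟨hhom, hilb⟩ := hilbert_choose f hquad hreg
  obtain ⟨α, β, γ, δ, hα, hf⟩ := normal_form f hquad hequiv
  have he : (∑ j, X j : MvPolynomial (Fin n) K).IsHomogeneous 1 :=
    IsHomogeneous.sum _ _ _ fun i _ => isHomogeneous_X K i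
  have key : ∀ l : MvPolynomial (Fin n) K, l.IsHomogeneous 1 →
      Surj (Ideal.span (Set.range f)) l → ∀ i ≤ n / 2,
      Set.BijOn (fun a => (Ideal.Quotient.mkₐ K (Ideal.span (Set.range f))) l ^ (n - 2 * i) * a)
        (𝒜 i) (𝒜 (n - i)) := by
    intro l hl hs i hi
    rw [h𝒜, h𝒜]
    exact bij_of_surj hilb hl hs i hi
  rcases core f hhom hilb α β γ δ hα hf with h | ⟨h1, l, hl, h⟩
  · exact ⟨⟨_, he, key _ he h⟩, fun _ => key _ he h⟩
  · exact ⟨⟨l, hl, key l hl h⟩, fun h2 => absurd h1 h2⟩
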